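/- Let A and B be graded 𝕜-algebras, I ⊆ A and J ⊆ B homogeneous two-sided ideals, A' = A/I and B' = B/J with graded projections π_A: A → A' and π_B: B → B', and let η_A: A' → A and η_B: B' → B be graded 𝕜-linear splittings (π_A η_A = id, π_B η_B = id). Suppose τ: B⊗A → A⊗B is a graded twisting map satisfying τ(B⊗I + J⊗A) ⊆ I⊗B + A⊗J. Then the linear map τ' : B'⊗A' → A'⊗B' given by τ' = (π_A⊗π_B)∘τ∘(η_B⊗η_A) is a graded twisting map (independent of the choice of splittings), and π_A⊗π_B: A⊗_τB → A'⊗_{τ'}B' is a graded algebra homomorphism. -/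

import Mathlib

open TensorProduct

noncomputable section

namespace TTP

variable (𝕜 : Type) [Field 𝕜]

/-- The image of `p ⊗ q` inside `M ⊗[𝕜] N`, for submodules `p ⊆ M`, `q ⊆ N`. -/
def subTmul {M N : Type} [AddCommGroup M] [Module 𝕜 M] [AddCommGroup N] [Module 𝕜 N]
    (p : Submodule 𝕜 M) (q : Submodule 𝕜 N) : Submodule 𝕜 (M ⊗[𝕜] N) :=
  LinearMap.range (TensorProduct.map p.subtype q.subtype)

/-- The Künneth grading on a tensor product of graded vector spaces. -/
def kunneth {M N : Type} [AddCommGroup M] [Module 𝕜 M] [AddCommGroup N] [Module 𝕜 N]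
    (𝒜 : ℕ → Submodule 𝕜 M) (ℬ : ℕ → Submodule 𝕜 N) (n : ℕ) : Submodule 𝕜 (M ⊗[𝕜] N) :=
  ⨆ (pq : ℕ × ℕ) (_ : pq.1 + pq.2 = n), subTmul 𝕜 (𝒜 pq.1) (ℬ pq.2)

/-- The positive part `X₊ = ⊕_{i>0} X_i` of a graded vector space. -/
def plusPart {M : Type} [AddCommGroup M] [Module 𝕜 M] (𝒜 : ℕ → Submodule 𝕜 M) :
    Submodule 𝕜 M :=
  ⨆ (i : ℕ) (_ : 0 < i), 𝒜 i

/-- The grading concentrating `𝒜 1` in degree `1` (and `⊥` elsewhere). -/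
def degOne {M : Type} [AddCommGroup M] [Module 𝕜 M] (𝒜 : ℕ → Submodule 𝕜 M) :
    ℕ → Submodule 𝕜 M :=
  fun n => if n = 1 then 𝒜 1 else ⊥

variable (A B : Type) [Ring A] [Algebra 𝕜 A] [Ring B] [Algebra 𝕜 B]

/-- `τ ∘ (μ_B ⊗ μ_A)` on `(B ⊗ B) ⊗ (A ⊗ A)`. -/
def twistLHS (τ : B ⊗[𝕜] A →ₗ[𝕜] A ⊗[𝕜] B) :
    (B ⊗[𝕜] B) ⊗[𝕜] (A ⊗[𝕜] A) →ₗ[𝕜] A ⊗[𝕜] B :=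
  τ ∘ₗ TensorProduct.map (LinearMap.mul' 𝕜 B) (LinearMap.mul' 𝕜 A)

/-- `(μ_A ⊗ μ_B) ∘ (1_A ⊗ τ ⊗ 1_B) ∘ (τ ⊗ τ) ∘ (1_B ⊗ τ ⊗ 1_A)` on `(B ⊗ B) ⊗ (A ⊗ A)`. -/
def twistRHS (τ : B ⊗[𝕜] A →ₗ[𝕜] A ⊗[𝕜] B) :
    (B ⊗[𝕜] B) ⊗[𝕜] (A ⊗[𝕜] A) →ₗ[𝕜] A ⊗[𝕜] B :=
  TensorProduct.map (LinearMap.mul' 𝕜 A) (LinearMap.mul' 𝕜 B)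
    ∘ₗ (TensorProduct.assoc 𝕜 A A (B ⊗[𝕜] B)).symm.toLinearMap
    ∘ₗ LinearMap.lTensor A (TensorProduct.assoc 𝕜 A B B).toLinearMap
    ∘ₗ LinearMap.lTensor A (LinearMap.rTensor B τ)
    ∘ₗ LinearMap.lTensor A (TensorProduct.assoc 𝕜 B A B).symm.toLinearMap
    ∘ₗ (TensorProduct.assoc 𝕜 A B (A ⊗[𝕜] B)).toLinearMap
    ∘ₗ TensorProduct.map τ τ
    ∘ₗ (TensorProduct.assoc 𝕜 B A (B ⊗[𝕜] A)).symm.toLinearMap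
    ∘ₗ LinearMap.lTensor B (TensorProduct.assoc 𝕜 A B A).toLinearMap
    ∘ₗ LinearMap.lTensor B (LinearMap.rTensor A τ)
    ∘ₗ LinearMap.lTensor B (TensorProduct.assoc 𝕜 B A A).symm.toLinearMap
    ∘ₗ (TensorProduct.assoc 𝕜 B B (A ⊗[𝕜] A)).toLinearMap

/-- `τ : B ⊗ A → A ⊗ B` is an (algebra) twisting map: it satisfies the unital twisting
conditions and `τ(μ_B ⊗ μ_A) = (μ_A ⊗ μ_B)(1_A ⊗ τ ⊗ 1_B)(τ ⊗ τ)(1_B ⊗ τ ⊗ 1_A)`. -/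
def IsTwisting (τ : B ⊗[𝕜] A →ₗ[𝕜] A ⊗[𝕜] B) : Prop :=
  (∀ a : A, τ ((1 : B) ⊗ₜ[𝕜] a) = a ⊗ₜ[𝕜] (1 : B)) ∧
  (∀ b : B, τ (b ⊗ₜ[𝕜] (1 : A)) = (1 : A) ⊗ₜ[𝕜] b) ∧
  twistLHS 𝕜 A B τ = twistRHS 𝕜 A B τ

/-- `τ` preserves the Künneth grading. -/
def IsGradedMapBA (𝒜 : ℕ → Submodule 𝕜 A) (ℬ : ℕ → Submodule 𝕜 B)
    (τ : B ⊗[𝕜] A →ₗ[𝕜] A ⊗[𝕜] B) : Prop :=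
  ∀ n, Submodule.map τ (kunneth 𝕜 ℬ 𝒜 n) ≤ kunneth 𝕜 𝒜 ℬ n

/-- `τ` is a graded twisting map. -/
def IsGradedTwisting (𝒜 : ℕ → Submodule 𝕜 A) (ℬ : ℕ → Submodule 𝕜 B)
    (τ : B ⊗[𝕜] A →ₗ[𝕜] A ⊗[𝕜] B) : Prop :=
  IsTwisting 𝕜 A B τ ∧ IsGradedMapBA 𝕜 A B 𝒜 ℬ τ

/-- A graded linear map `τ` is graded twisting to degree `n`:  it satisfies the unital
conditions and the twisting identity in all (Künneth) degrees `≤ n`. -/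
def TwistingToDeg (𝒜 : ℕ → Submodule 𝕜 A) (ℬ : ℕ → Submodule 𝕜 B)
    (τ : B ⊗[𝕜] A →ₗ[𝕜] A ⊗[𝕜] B) (n : ℕ) : Prop :=
  IsGradedMapBA 𝕜 A B 𝒜 ℬ τ ∧
  (∀ j ≤ n, ∀ a ∈ 𝒜 j, τ ((1 : B) ⊗ₜ[𝕜] a) = a ⊗ₜ[𝕜] (1 : B)) ∧
  (∀ j ≤ n, ∀ b ∈ ℬ j, τ (b ⊗ₜ[𝕜] (1 : A)) = (1 : A) ⊗ₜ[𝕜] b) ∧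
  (∀ j ≤ n, ∀ x ∈ kunneth 𝕜 (kunneth 𝕜 ℬ ℬ) (kunneth 𝕜 𝒜 𝒜) j,
    twistLHS 𝕜 A B τ x = twistRHS 𝕜 A B τ x)

/-- The unique extension property of a graded twisting map:  for every `n ≥ 3`, any
linear map `τ'` that is graded twisting to degree `n` and agrees with `τ` in all degrees
`< n` also agrees with `τ` in degree `n`. -/
def UEP (𝒜 : ℕ → Submodule 𝕜 A) (ℬ : ℕ → Submodule 𝕜 B)
    (τ : B ⊗[𝕜] A →ₗ[𝕜] A ⊗[𝕜] B) : Prop :=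
  ∀ n, 3 ≤ n → ∀ τ' : B ⊗[𝕜] A →ₗ[𝕜] A ⊗[𝕜] B,
    TwistingToDeg 𝕜 A B 𝒜 ℬ τ' n →
    (∀ i < n, ∀ x ∈ kunneth 𝕜 ℬ 𝒜 i, τ' x = τ x) →
    ∀ x ∈ kunneth 𝕜 ℬ 𝒜 n, τ' x = τ x

/-- The multiplication `μ_τ = (μ_A ⊗ μ_B)(1_A ⊗ τ ⊗ 1_B)` on `A ⊗ B`. -/
def mulTau (τ : B ⊗[𝕜] A →ₗ[𝕜] A ⊗[𝕜] B) :
    (A ⊗[𝕜] B) ⊗[𝕜] (A ⊗[𝕜] B) →ₗ[𝕜] A ⊗[𝕜] B :=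
  TensorProduct.map (LinearMap.mul' 𝕜 A) (LinearMap.mul' 𝕜 B)
    ∘ₗ (TensorProduct.assoc 𝕜 A A (B ⊗[𝕜] B)).symm.toLinearMap
    ∘ₗ LinearMap.lTensor A (TensorProduct.assoc 𝕜 A B B).toLinearMap
    ∘ₗ LinearMap.lTensor A (LinearMap.rTensor B τ)
    ∘ₗ LinearMap.lTensor A (TensorProduct.assoc 𝕜 B A B).symm.toLinearMap
    ∘ₗ (TensorProduct.assoc 𝕜 A B (A ⊗[𝕜] B)).toLinearMap

/-- `(C, ψ)` realizes the twisted tensor product algebra `A ⊗_τ B`:  `ψ` is a linear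
isomorphism carrying the multiplication `μ_τ` and its unit to those of `C`. -/
def Realizes (τ : B ⊗[𝕜] A →ₗ[𝕜] A ⊗[𝕜] B) (C : Type) [Ring C] [Algebra 𝕜 C]
    (ψ : A ⊗[𝕜] B →ₗ[𝕜] C) : Prop :=
  Function.Bijective ψ ∧ ψ ((1 : A) ⊗ₜ[𝕜] (1 : B)) = 1 ∧
  ∀ x y : A ⊗[𝕜] B, ψ (mulTau 𝕜 A B τ (x ⊗ₜ[𝕜] y)) = ψ x * ψ y

/-- The two-sided ideal generated by a subset, as a `𝕜`-submodule. -/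
def idealSpan (C : Type) [Ring C] [Algebra 𝕜 C] (s : Set C) : Submodule 𝕜 C :=
  Submodule.span 𝕜 {x | ∃ c d r, r ∈ s ∧ x = c * r * d}

/-- Weight grading of the tensor algebra. -/
def tensorWeight (V : Type) [AddCommGroup V] [Module 𝕜 V] (n : ℕ) :
    Submodule 𝕜 (TensorAlgebra 𝕜 V) :=
  LinearMap.range (TensorAlgebra.ι 𝕜 (M := V)) ^ n

instance (V : Type) [AddCommGroup V] [Module 𝕜 V] : GradedAlgebra (tensorWeight 𝕜 V) :=
  inferInstanceAs (GradedAlgebra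
    ((LinearMap.range (TensorAlgebra.ι 𝕜 : V →ₗ[𝕜] TensorAlgebra 𝕜 V) ^ ·) : ℕ → Submodule 𝕜 _))

/-- The canonical map `T(C₁) → C` for a graded algebra `C`. -/
def canMap (C : Type) [Ring C] [Algebra 𝕜 C] (𝒞 : ℕ → Submodule 𝕜 C) :
    TensorAlgebra 𝕜 ↥(𝒞 1) →ₐ[𝕜] C :=
  TensorAlgebra.lift 𝕜 (𝒞 1).subtype

/-- `C` (with grading `𝒞`) is a quadratic algebra: the canonical map `T(C₁) → C` is
surjective and its kernel is generated, as a two-sided ideal, by its degree 2 part. -/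
def IsQuadraticAlg (C : Type) [Ring C] [Algebra 𝕜 C] (𝒞 : ℕ → Submodule 𝕜 C) : Prop :=
  Function.Surjective (canMap 𝕜 C 𝒞) ∧
  LinearMap.ker (canMap 𝕜 C 𝒞).toLinearMap =
    idealSpan 𝕜 (TensorAlgebra 𝕜 ↥(𝒞 1))
      ((LinearMap.ker (canMap 𝕜 C 𝒞).toLinearMap ⊓ tensorWeight 𝕜 ↥(𝒞 1) 2 : Submodule 𝕜 _) : Set _)

/-- The left ideal generated by the positive part of a graded algebra. -/
def augIdeal (C : Type) [Ring C] [Algebra 𝕜 C] (𝒞 : ℕ → Submodule 𝕜 C) : Submodule C C :=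
  Submodule.span C {x : C | ∃ i, 0 < i ∧ x ∈ 𝒞 i}

/-- The degree `n` component of the graded free module on generators `σ` in degree `i`. -/
def freeGrade (C : Type) [Ring C] [Algebra 𝕜 C] (𝒞 : ℕ → Submodule 𝕜 C)
    (i : ℕ) (σ : Type) (n : ℕ) : Submodule 𝕜 (σ →₀ C) :=
  ⨅ (j : σ), Submodule.comap (Finsupp.lapply j : (σ →₀ C) →ₗ[𝕜] C)
    (if i ≤ n then 𝒞 (n - i) else ⊥)

/-- `C` (with grading `𝒞`) is a Koszul algebra: the trivial module `𝕜 = C/C₊` admits a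
resolution by graded free modules with the `i`-th term generated in degree `i`. -/
def IsKoszul (C : Type) [Ring C] [Algebra 𝕜 C] (𝒞 : ℕ → Submodule 𝕜 C) : Prop :=
  ∃ (σ : ℕ → Type) (d : ∀ i : ℕ, ((σ (i + 1)) →₀ C) →ₗ[C] ((σ i) →₀ C))
    (ε : ((σ 0) →₀ C) →ₗ[C] (C ⧸ augIdeal 𝕜 C 𝒞)),
    Function.Surjective ε ∧
    LinearMap.ker ε = LinearMap.range (d 0) ∧
    (∀ i, LinearMap.ker (d i) = LinearMap.range (d (i + 1))) ∧
    (∀ i n, ∀ x ∈ freeGrade 𝕜 C 𝒞 (i + 1) (σ (i + 1)) n, d i x ∈ freeGrade 𝕜 C 𝒞 i (σ i) n) ∧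
    (∀ n, 0 < n → ∀ x ∈ freeGrade 𝕜 C 𝒞 0 (σ 0) n, ε x = 0)

/-- `(P, ιA, ιB)` is a free product (coproduct) of `A` and `B`. -/
def IsFreeProduct (P : Type) [Ring P] [Algebra 𝕜 P] (ιA : A →ₐ[𝕜] P) (ιB : B →ₐ[𝕜] P) :
    Prop :=
  ∀ (C : Type) [Ring C] [Algebra 𝕜 C], ∀ (f : A →ₐ[𝕜] C) (g : B →ₐ[𝕜] C),
    ∃! h : P →ₐ[𝕜] C, h.comp ιA = f ∧ h.comp ιB = g

/-- The linear map `A ⊗ B → P`, `a ⊗ b ↦ ιA(a) · ιB(b)`. -/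
def mulMapP (P : Type) [Ring P] [Algebra 𝕜 P] (ιA : A →ₐ[𝕜] P) (ιB : B →ₐ[𝕜] P) :
    A ⊗[𝕜] B →ₗ[𝕜] P :=
  TensorProduct.lift (LinearMap.mk₂ 𝕜 (fun a b => ιA a * ιB b)
    (fun a a' b => by simp [map_add, add_mul])
    (fun c a b => by simp [map_smul, smul_mul_assoc])
    (fun a b b' => by simp [map_add, mul_add])
    (fun c a b => by simp [map_smul, mul_smul_comm]))

/-- The set of `τ`-relations `b ⊗ a - τ(b ⊗ a)` of total degree at most `n`,
inside the free product `P`. -/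
def relSetLe (P : Type) [Ring P] [Algebra 𝕜 P] (ιA : A →ₐ[𝕜] P) (ιB : B →ₐ[𝕜] P)
    (𝒜 : ℕ → Submodule 𝕜 A) (ℬ : ℕ → Submodule 𝕜 B)
    (τ : B ⊗[𝕜] A →ₗ[𝕜] A ⊗[𝕜] B) (n : ℕ) : Set P :=
  {x | ∃ i j a b, i + j ≤ n ∧ a ∈ 𝒜 i ∧ b ∈ ℬ j ∧
    x = ιB b * ιA a - mulMapP 𝕜 A B P ιA ιB (τ (b ⊗ₜ[𝕜] a))}

/-- The set of all `τ`-relations `b ⊗ a - τ(b ⊗ a)` inside the free product `P`. -/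
def relSetAll (P : Type) [Ring P] [Algebra 𝕜 P] (ιA : A →ₐ[𝕜] P) (ιB : B →ₐ[𝕜] P)
    (τ : B ⊗[𝕜] A →ₗ[𝕜] A ⊗[𝕜] B) : Set P :=
  {x | ∃ a b, x = ιB b * ιA a - mulMapP 𝕜 A B P ιA ιB (τ (b ⊗ₜ[𝕜] a))}

/-- The (Künneth) grading on the free product `P` of the graded algebras `A` and `B`. -/
def freeProdGrade (P : Type) [Ring P] [Algebra 𝕜 P] (ιA : A →ₐ[𝕜] P) (ιB : B →ₐ[𝕜] P)
    (𝒜 : ℕ → Submodule 𝕜 A) (ℬ : ℕ → Submodule 𝕜 B) (n : ℕ) : Submodule 𝕜 P :=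
  ⨆ (l : List ℕ) (_ : l.sum = n),
    ((l.map (fun i => Submodule.map ιA.toLinearMap (𝒜 i) ⊔ Submodule.map ιB.toLinearMap (ℬ i))).foldr
      (· * ·) 1)

end TTP

namespace TTP

section Kunneth

variable {𝕜 : Type} [Field 𝕜] {M N M' N' : Type}
  [AddCommGroup M] [Module 𝕜 M] [AddCommGroup N] [Module 𝕜 N]
  [AddCommGroup M'] [Module 𝕜 M'] [AddCommGroup N'] [Module 𝕜 N']

theorem tmul_mem_subTmul {p : Submodule 𝕜 M} {q : Submodule 𝕜 N} {x : M} {y : N}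
    (hx : x ∈ p) (hy : y ∈ q) : x ⊗ₜ[𝕜] y ∈ subTmul 𝕜 p q :=
  ⟨(⟨x, hx⟩ : p) ⊗ₜ[𝕜] (⟨y, hy⟩ : q), by simp⟩

theorem subTmul_le {p : Submodule 𝕜 M} {q : Submodule 𝕜 N} {S : Submodule 𝕜 (M ⊗[𝕜] N)}
    (h : ∀ x ∈ p, ∀ y ∈ q, x ⊗ₜ[𝕜] y ∈ S) : subTmul 𝕜 p q ≤ S := by
  rintro _ ⟨t, rfl⟩
  induction t with
  | zero => simp
  | tmul x y => simpa using h x x.2 y y.2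
  | add s t hs ht => simpa using S.add_mem hs ht

theorem map_kunneth_le {𝒜 : ℕ → Submodule 𝕜 M} {ℬ : ℕ → Submodule 𝕜 N}
    {𝒜' : ℕ → Submodule 𝕜 M'} {ℬ' : ℕ → Submodule 𝕜 N'} {f : M →ₗ[𝕜] M'} {g : N →ₗ[𝕜] N'}
    (hf : ∀ n, Submodule.map f (𝒜 n) ≤ 𝒜' n) (hg : ∀ n, Submodule.map g (ℬ n) ≤ ℬ' n) (n : ℕ) :
    Submodule.map (TensorProduct.map f g) (kunneth 𝕜 𝒜 ℬ n) ≤ kunneth 𝕜 𝒜' ℬ' n := by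
  rw [Submodule.map_le_iff_le_comap]
  refine iSup₂_le fun pq hpq => subTmul_le fun x hx y hy => ?_
  exact (le_iSup₂ (f := fun (pq : ℕ × ℕ) (_ : pq.1 + pq.2 = n) =>
    subTmul 𝕜 (𝒜' pq.1) (ℬ' pq.2)) pq hpq)
    (tmul_mem_subTmul (hf _ ⟨x, hx, rfl⟩) (hg _ ⟨y, hy, rfl⟩))

end Kunneth

section Naturality

variable {𝕜 : Type} [Field 𝕜] {A B A' B' : Type} [Ring A] [Algebra 𝕜 A] [Ring B] [Algebra 𝕜 B]
  [Ring A'] [Algebra 𝕜 A'] [Ring B'] [Algebra 𝕜 B']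

theorem mulTau_tmul (τ : B ⊗[𝕜] A →ₗ[𝕜] A ⊗[𝕜] B) (a a' : A) (b b' : B) :
    mulTau 𝕜 A B τ ((a ⊗ₜ[𝕜] b) ⊗ₜ[𝕜] (a' ⊗ₜ[𝕜] b')) =
      TensorProduct.map (LinearMap.mulLeft 𝕜 a) (LinearMap.mulRight 𝕜 b') (τ (b ⊗ₜ[𝕜] a')) := by
  simp only [mulTau, LinearMap.comp_apply, LinearEquiv.coe_coe, TensorProduct.assoc_tmul,
    LinearMap.lTensor_tmul, TensorProduct.assoc_symm_tmul, LinearMap.rTensor_tmul]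
  induction τ (b ⊗ₜ[𝕜] a') with
  | zero => simp
  | tmul x y => simp
  | add s t hs ht => simp only [TensorProduct.add_tmul, TensorProduct.tmul_add, map_add, hs, ht]

/-- The map `(b ⊗ b') ⊗ (a ⊗ a') ↦ (b ⊗ x) ⊗ (y ⊗ a')` where `τ (b' ⊗ a) = x ⊗ y`. -/
def twistMiddle (τ : B ⊗[𝕜] A →ₗ[𝕜] A ⊗[𝕜] B) :
    (B ⊗[𝕜] B) ⊗[𝕜] (A ⊗[𝕜] A) →ₗ[𝕜] (B ⊗[𝕜] A) ⊗[𝕜] (B ⊗[𝕜] A) :=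
  (TensorProduct.assoc 𝕜 B A (B ⊗[𝕜] A)).symm.toLinearMap
    ∘ₗ LinearMap.lTensor B (TensorProduct.assoc 𝕜 A B A).toLinearMap
    ∘ₗ LinearMap.lTensor B (LinearMap.rTensor A τ)
    ∘ₗ LinearMap.lTensor B (TensorProduct.assoc 𝕜 B A A).symm.toLinearMap
    ∘ₗ (TensorProduct.assoc 𝕜 B B (A ⊗[𝕜] A)).toLinearMap

theorem twistRHS_eq (τ : B ⊗[𝕜] A →ₗ[𝕜] A ⊗[𝕜] B) :
    twistRHS 𝕜 A B τ = mulTau 𝕜 A B τ ∘ₗ TensorProduct.map τ τ ∘ₗ twistMiddle τ :=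
  rfl

theorem twistMiddle_tmul (τ : B ⊗[𝕜] A →ₗ[𝕜] A ⊗[𝕜] B) (a a' : A) (b b' : B) :
    twistMiddle τ ((b ⊗ₜ[𝕜] b') ⊗ₜ[𝕜] (a ⊗ₜ[𝕜] a')) =
      TensorProduct.map (TensorProduct.mk 𝕜 B A b) ((TensorProduct.mk 𝕜 B A).flip a')
        (τ (b' ⊗ₜ[𝕜] a)) := by
  simp only [twistMiddle, LinearMap.comp_apply, LinearEquiv.coe_coe, TensorProduct.assoc_tmul,
    LinearMap.lTensor_tmul, TensorProduct.assoc_symm_tmul, LinearMap.rTensor_tmul]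
  induction τ (b' ⊗ₜ[𝕜] a) with
  | zero => simp
  | tmul x y => simp
  | add s t hs ht => simp only [TensorProduct.add_tmul, TensorProduct.tmul_add, map_add, hs, ht]

variable {f : A →ₐ[𝕜] A'} {g : B →ₐ[𝕜] B'}
  {τ : B ⊗[𝕜] A →ₗ[𝕜] A ⊗[𝕜] B} {σ : B' ⊗[𝕜] A' →ₗ[𝕜] A' ⊗[𝕜] B'}

theorem map_comp_mulTau
    (h : σ ∘ₗ TensorProduct.map g.toLinearMap f.toLinearMap =
      TensorProduct.map f.toLinearMap g.toLinearMap ∘ₗ τ) :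
    TensorProduct.map f.toLinearMap g.toLinearMap ∘ₗ mulTau 𝕜 A B τ =
      mulTau 𝕜 A' B' σ ∘ₗ TensorProduct.map (TensorProduct.map f.toLinearMap g.toLinearMap)
        (TensorProduct.map f.toLinearMap g.toLinearMap) := by
  refine TensorProduct.ext_fourfold' fun a b a' b' => ?_
  have h' := LinearMap.congr_fun h (b ⊗ₜ[𝕜] a')
  simp only [LinearMap.comp_apply, TensorProduct.map_tmul] at h' ⊢
  rw [mulTau_tmul, mulTau_tmul, h']
  induction τ (b ⊗ₜ[𝕜] a') with
  | zero => simp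
  | tmul x y => simp
  | add s t hs ht => simp only [map_add, hs, ht]

theorem map_comp_twistMiddle
    (h : σ ∘ₗ TensorProduct.map g.toLinearMap f.toLinearMap =
      TensorProduct.map f.toLinearMap g.toLinearMap ∘ₗ τ) :
    TensorProduct.map (TensorProduct.map g.toLinearMap f.toLinearMap)
        (TensorProduct.map g.toLinearMap f.toLinearMap) ∘ₗ twistMiddle τ =
      twistMiddle σ ∘ₗ TensorProduct.map (TensorProduct.map g.toLinearMap g.toLinearMap)
        (TensorProduct.map f.toLinearMap f.toLinearMap) := by
  refine TensorProduct.ext_fourfold' fun b b' a a' => ?_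
  have h' := LinearMap.congr_fun h (b' ⊗ₜ[𝕜] a)
  simp only [LinearMap.comp_apply, TensorProduct.map_tmul] at h' ⊢
  rw [twistMiddle_tmul, twistMiddle_tmul, h']
  induction τ (b' ⊗ₜ[𝕜] a) with
  | zero => simp
  | tmul x y => simp
  | add s t hs ht => simp only [map_add, hs, ht]

theorem map_comp_twistLHS
    (h : σ ∘ₗ TensorProduct.map g.toLinearMap f.toLinearMap =
      TensorProduct.map f.toLinearMap g.toLinearMap ∘ₗ τ) :
    TensorProduct.map f.toLinearMap g.toLinearMap ∘ₗ twistLHS 𝕜 A B τ =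
      twistLHS 𝕜 A' B' σ ∘ₗ TensorProduct.map (TensorProduct.map g.toLinearMap g.toLinearMap)
        (TensorProduct.map f.toLinearMap f.toLinearMap) := by
  refine TensorProduct.ext_fourfold' fun b b' a a' => ?_
  have h' := LinearMap.congr_fun h ((b * b') ⊗ₜ[𝕜] (a * a'))
  simpa [twistLHS] using h'.symm

theorem map_comp_twistRHS
    (h : σ ∘ₗ TensorProduct.map g.toLinearMap f.toLinearMap =
      TensorProduct.map f.toLinearMap g.toLinearMap ∘ₗ τ) :
    TensorProduct.map f.toLinearMap g.toLinearMap ∘ₗ twistRHS 𝕜 A B τ =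
      twistRHS 𝕜 A' B' σ ∘ₗ TensorProduct.map (TensorProduct.map g.toLinearMap g.toLinearMap)
        (TensorProduct.map f.toLinearMap f.toLinearMap) := by
  rw [twistRHS_eq, twistRHS_eq, ← LinearMap.comp_assoc, map_comp_mulTau h, LinearMap.comp_assoc,
    LinearMap.comp_assoc, LinearMap.comp_assoc, ← map_comp_twistMiddle h]
  simp only [← LinearMap.comp_assoc (twistMiddle τ)]
  rw [LinearMap.comp_assoc, ← TensorProduct.map_comp, ← TensorProduct.map_comp, h,
    LinearMap.comp_assoc]

/-- A twisting map descends along surjective algebra homomorphisms. -/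
theorem IsTwisting.of_surjective (hf : Function.Surjective f) (hg : Function.Surjective g)
    (h : σ ∘ₗ TensorProduct.map g.toLinearMap f.toLinearMap =
      TensorProduct.map f.toLinearMap g.toLinearMap ∘ₗ τ)
    (hτ : IsTwisting 𝕜 A B τ) : IsTwisting 𝕜 A' B' σ := by
  refine ⟨fun a' => ?_, fun b' => ?_, ?_⟩
  · obtain ⟨a, rfl⟩ := hf a'
    simpa [hτ.1] using LinearMap.congr_fun h (1 ⊗ₜ[𝕜] a)
  · obtain ⟨b, rfl⟩ := hg b'
    simpa [hτ.2.1] using LinearMap.congr_fun h (b ⊗ₜ[𝕜] 1)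
  · have hsurj : Function.Surjective
        (TensorProduct.map (TensorProduct.map g.toLinearMap g.toLinearMap)
          (TensorProduct.map f.toLinearMap f.toLinearMap)) :=
      TensorProduct.map_surjective (TensorProduct.map_surjective hg hg)
        (TensorProduct.map_surjective hf hf)
    rw [← LinearMap.cancel_right hsurj, ← map_comp_twistLHS h, ← map_comp_twistRHS h, hτ.2.2]

/-- The map induced by `τ` through splittings of `f` and `g` intertwines with `τ`, as soon as `τ`
preserves the kernels of the projections. -/
theorem induced_comp_map {ηA : A' →ₗ[𝕜] A} {ηB : B' →ₗ[𝕜] B}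
    (hηA : ∀ x, f (ηA x) = x) (hηB : ∀ x, g (ηB x) = x)
    (hker : Submodule.map τ
        (subTmul 𝕜 (⊤ : Submodule 𝕜 B) (LinearMap.ker f.toLinearMap) ⊔
          subTmul 𝕜 (LinearMap.ker g.toLinearMap) (⊤ : Submodule 𝕜 A)) ≤
      subTmul 𝕜 (LinearMap.ker f.toLinearMap) (⊤ : Submodule 𝕜 B) ⊔
        subTmul 𝕜 (⊤ : Submodule 𝕜 A) (LinearMap.ker g.toLinearMap)) :
    (TensorProduct.map f.toLinearMap g.toLinearMap ∘ₗ τ ∘ₗ TensorProduct.map ηB ηA) ∘ₗ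
        TensorProduct.map g.toLinearMap f.toLinearMap =
      TensorProduct.map f.toLinearMap g.toLinearMap ∘ₗ τ := by
  have hle : subTmul 𝕜 (LinearMap.ker f.toLinearMap) (⊤ : Submodule 𝕜 B) ⊔
      subTmul 𝕜 (⊤ : Submodule 𝕜 A) (LinearMap.ker g.toLinearMap) ≤
      LinearMap.ker (TensorProduct.map f.toLinearMap g.toLinearMap) := by
    refine sup_le (subTmul_le fun x hx y _ => ?_) (subTmul_le fun x _ y hy => ?_)
    · rw [LinearMap.mem_ker] at hx ⊢
      rw [TensorProduct.map_tmul, hx, TensorProduct.zero_tmul]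
    · rw [LinearMap.mem_ker] at hy ⊢
      rw [TensorProduct.map_tmul, hy, TensorProduct.tmul_zero]
  refine TensorProduct.ext' fun b a => ?_
  have hmem : ηB (g b) ⊗ₜ[𝕜] ηA (f a) - b ⊗ₜ[𝕜] a ∈
      subTmul 𝕜 (⊤ : Submodule 𝕜 B) (LinearMap.ker f.toLinearMap) ⊔
        subTmul 𝕜 (LinearMap.ker g.toLinearMap) (⊤ : Submodule 𝕜 A) := by
    have hsplit : ηB (g b) ⊗ₜ[𝕜] ηA (f a) - b ⊗ₜ[𝕜] a =
        b ⊗ₜ[𝕜] (ηA (f a) - a) + (ηB (g b) - b) ⊗ₜ[𝕜] ηA (f a) := by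
      rw [TensorProduct.tmul_sub, TensorProduct.sub_tmul]
      abel
    rw [hsplit]
    refine Submodule.add_mem_sup (tmul_mem_subTmul trivial ?_) (tmul_mem_subTmul ?_ trivial)
    · simp [hηA]
    · simp [hηB]
  have hzero := hle (hker ⟨_, hmem, rfl⟩)
  rw [LinearMap.mem_ker, map_sub, map_sub, sub_eq_zero] at hzero
  simpa using hzero

end Naturality

/-- Theorem 3.6 (`inducedTau`).  Let `π_A : A → A'` and `π_B : B → B'` be surjective
graded algebra maps (so `A' = A/I`, `B' = B/J` with `I = ker π_A`, `J = ker π_B`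
homogeneous two-sided ideals), with graded linear splittings `η_A`, `η_B`.  If
`τ : B ⊗ A → A ⊗ B` is a graded twisting map with `τ(B ⊗ I + J ⊗ A) ⊆ I ⊗ B + A ⊗ J`,
then `τ' = (π_A ⊗ π_B) ∘ τ ∘ (η_B ⊗ η_A)` is a graded twisting map, independent of the
choice of graded splittings, and `π_A ⊗ π_B : A ⊗_τ B → A' ⊗_{τ'} B'` is a (graded)
algebra homomorphism. -/
theorem stmt5 (𝕜 : Type) [Field 𝕜]
    (A B A' B' : Type) [Ring A] [Algebra 𝕜 A] [Ring B] [Algebra 𝕜 B]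
    [Ring A'] [Algebra 𝕜 A'] [Ring B'] [Algebra 𝕜 B']
    (𝒜 : ℕ → Submodule 𝕜 A) (ℬ : ℕ → Submodule 𝕜 B)
    (𝒜' : ℕ → Submodule 𝕜 A') (ℬ' : ℕ → Submodule 𝕜 B')
    [GradedAlgebra 𝒜] [GradedAlgebra ℬ] [GradedAlgebra 𝒜'] [GradedAlgebra ℬ']
    (πA : A →ₐ[𝕜] A') (πB : B →ₐ[𝕜] B')
    (hπA : Function.Surjective πA) (hπB : Function.Surjective πB)
    (hπAgr : ∀ n, Submodule.map πA.toLinearMap (𝒜 n) = 𝒜' n)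
    (hπBgr : ∀ n, Submodule.map πB.toLinearMap (ℬ n) = ℬ' n)
    (ηA : A' →ₗ[𝕜] A) (ηB : B' →ₗ[𝕜] B)
    (hηA : ∀ x, πA (ηA x) = x) (hηB : ∀ x, πB (ηB x) = x)
    (hηAgr : ∀ n, Submodule.map ηA (𝒜' n) ≤ 𝒜 n)
    (hηBgr : ∀ n, Submodule.map ηB (ℬ' n) ≤ ℬ n)
    (τ : B ⊗[𝕜] A →ₗ[𝕜] A ⊗[𝕜] B)
    (hτ : IsGradedTwisting 𝕜 A B 𝒜 ℬ τ)
    (hIJ : Submodule.map τ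
        (subTmul 𝕜 (⊤ : Submodule 𝕜 B) (LinearMap.ker πA.toLinearMap) ⊔
          subTmul 𝕜 (LinearMap.ker πB.toLinearMap) (⊤ : Submodule 𝕜 A)) ≤
      subTmul 𝕜 (LinearMap.ker πA.toLinearMap) (⊤ : Submodule 𝕜 B) ⊔
        subTmul 𝕜 (⊤ : Submodule 𝕜 A) (LinearMap.ker πB.toLinearMap)) :
    IsGradedTwisting 𝕜 A' B' 𝒜' ℬ'
      (TensorProduct.map πA.toLinearMap πB.toLinearMap ∘ₗ τ ∘ₗ TensorProduct.map ηB ηA) ∧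
    (∀ (ηA' : A' →ₗ[𝕜] A) (ηB' : B' →ₗ[𝕜] B),
      (∀ x, πA (ηA' x) = x) → (∀ x, πB (ηB' x) = x) →
      (∀ n, Submodule.map ηA' (𝒜' n) ≤ 𝒜 n) → (∀ n, Submodule.map ηB' (ℬ' n) ≤ ℬ n) →
      TensorProduct.map πA.toLinearMap πB.toLinearMap ∘ₗ τ ∘ₗ TensorProduct.map ηB' ηA' =
        TensorProduct.map πA.toLinearMap πB.toLinearMap ∘ₗ τ ∘ₗ TensorProduct.map ηB ηA) ∧
    (∀ x y : A ⊗[𝕜] B,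
      TensorProduct.map πA.toLinearMap πB.toLinearMap (mulTau 𝕜 A B τ (x ⊗ₜ[𝕜] y)) =
        mulTau 𝕜 A' B'
          (TensorProduct.map πA.toLinearMap πB.toLinearMap ∘ₗ τ ∘ₗ TensorProduct.map ηB ηA)
          ((TensorProduct.map πA.toLinearMap πB.toLinearMap x) ⊗ₜ[𝕜]
            (TensorProduct.map πA.toLinearMap πB.toLinearMap y))) := by
  have key := induced_comp_map hηA hηB hIJ
  refine ⟨⟨hτ.1.of_surjective hπA hπB key, fun n => ?_⟩, fun ηA' ηB' hA hB _ _ => ?_,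
    fun x y => LinearMap.congr_fun (map_comp_mulTau key) (x ⊗ₜ[𝕜] y)⟩
  · rw [Submodule.map_comp, Submodule.map_comp]
    exact (Submodule.map_mono ((Submodule.map_mono (map_kunneth_le hηBgr hηAgr n)).trans
      (hτ.2 n))).trans (map_kunneth_le (fun n => (hπAgr n).le) (fun n => (hπBgr n).le) n)
  · have hsurj : Function.Surjective (TensorProduct.map πB.toLinearMap πA.toLinearMap) :=
      TensorProduct.map_surjective hπB hπA
    rw [← LinearMap.cancel_right hsurj, induced_comp_map hA hB hIJ, key]

end TTP
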